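/- arXiv:0805.1909 — 6 statements merged into one kernel-verified Lean document; each statement's English description precedes it below -/
import Mathlib

section
/- Let A be an associative unital algebra over a field k. For any integers m, l ≥ 2, the product of ideals M_m(A)·M_l(A) is contained in M_{m+l-2}(A). -/
noncomputable section

/-- `lcs k A n` is the `(n+1)`-st term `L_{n+1}(A)` of the lower central series of `A`
regarded as a Lie algebra under the commutator `[a,b] = a*b - b*a`:
`lcs k A 0 = L_1(A) = A` and `L_{n+2}(A) = span [A, L_{n+1}(A)]`. -/
def lcs (k A : Type*) [Field k] [Ring A] [Algebra k A] : ℕ → Submodule k A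
  | 0 => ⊤
  | n + 1 => Submodule.span k {x | ∃ a : A, ∃ b ∈ lcs k A n, x = a * b - b * a}

/-- `Lser k A i = L_i(A)` for `i ≥ 1`. -/
def Lser (k A : Type*) [Field k] [Ring A] [Algebra k A] (i : ℕ) : Submodule k A :=
  lcs k A (i - 1)

/-- The two-sided ideal of `A` generated by a set `S`, as a `k`-submodule. -/
def idealGen (k : Type*) {A : Type*} [Field k] [Ring A] [Algebra k A] (S : Set A) :
    Submodule k A :=
  Submodule.span k {x | ∃ a b : A, ∃ s ∈ S, x = a * s * b}

/-- `Mser k A i = M_i(A)`, the two-sided ideal of `A` generated by `L_i(A)`. -/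
def Mser (k A : Type*) [Field k] [Ring A] [Algebra k A] (i : ℕ) : Submodule k A :=
  idealGen k (Lser k A i : Set A)

section

variable {k A : Type*} [Field k] [Ring A] [Algebra k A]

theorem commutator_mem_lcs_succ (a : A) {n : ℕ} {b : A} (hb : b ∈ lcs k A n) :
    a * b - b * a ∈ lcs k A (n + 1) :=
  Submodule.subset_span ⟨a, b, hb, rfl⟩

theorem lcs_succ_le (n : ℕ) : lcs k A (n + 1) ≤ lcs k A n := by
  induction n with
  | zero => exact le_top
  | succ n ih =>
    refine Submodule.span_le.2 ?_
    rintro _ ⟨a, b, hb, rfl⟩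
    exact commutator_mem_lcs_succ a (ih hb)

theorem lcs_antitone : Antitone (lcs k A) :=
  antitone_nat_of_succ_le lcs_succ_le

theorem commutator_mem_lcs_add {i j : ℕ} {x y : A} (hx : x ∈ lcs k A i) (hy : y ∈ lcs k A j) :
    x * y - y * x ∈ lcs k A (i + j + 1) := by
  induction i generalizing j x y with
  | zero => simpa using commutator_mem_lcs_succ x hy
  | succ i ih =>
    induction hx using Submodule.span_induction with
    | mem _ h =>
      obtain ⟨a, b, hb, rfl⟩ := h
      have h₁ := commutator_mem_lcs_succ a (ih hb hy)
      have h₂ := ih hb (commutator_mem_lcs_succ a hy)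
      rw [show i + (j + 1) + 1 = i + 1 + j + 1 by omega] at h₂
      rw [show i + j + 1 + 1 = i + 1 + j + 1 by omega] at h₁
      convert sub_mem h₁ h₂ using 1
      noncomm_ring
    | zero => simp
    | add u v _ _ hu hv =>
      convert add_mem hu hv using 1
      noncomm_ring
    | smul c u _ hu =>
      convert Submodule.smul_mem _ c hu using 1
      simp [smul_sub]

theorem mul_mem_idealGen {S : Set A} (c : A) {x : A} (hx : x ∈ idealGen k S) :
    c * x ∈ idealGen k S := by
  have h : idealGen k S ≤ (idealGen k S).comap (LinearMap.mulLeft k c) := by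
    refine Submodule.span_le.2 ?_
    rintro _ ⟨a, b, s, hs, rfl⟩
    exact Submodule.subset_span ⟨c * a, b, s, hs, by simp [mul_assoc]⟩
  exact h hx

theorem idealGen_mul_mem {S : Set A} (c : A) {x : A} (hx : x ∈ idealGen k S) :
    x * c ∈ idealGen k S := by
  have h : idealGen k S ≤ (idealGen k S).comap (LinearMap.mulRight k c) := by
    refine Submodule.span_le.2 ?_
    rintro _ ⟨a, b, s, hs, rfl⟩
    exact Submodule.subset_span ⟨a, b * c, s, hs, by simp [mul_assoc]⟩
  exact h hx

theorem subset_idealGen {S : Set A} {x : A} (hx : x ∈ S) : x ∈ idealGen k S :=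
  Submodule.subset_span ⟨1, 1, x, hx, by simp⟩

variable (k A) in
/-- The span of the products, in either order, of an element of `lcs k A i` and an element of
`lcs k A i'` with `i ≤ j` and `i + i' = b + j`. -/
def lcsProducts (b j : ℕ) : Submodule k A :=
  Submodule.span k {x | ∃ i i', i ≤ j ∧ i + i' = b + j ∧
    ∃ p ∈ lcs k A i, ∃ q ∈ lcs k A i', x = p * q ∨ x = q * p}

theorem mul_mem_lcsProducts {b j i i' : ℕ} (hi : i ≤ j) (h : i + i' = b + j) {p q : A}
    (hp : p ∈ lcs k A i) (hq : q ∈ lcs k A i') : p * q ∈ lcsProducts k A b j :=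
  Submodule.subset_span ⟨i, i', hi, h, p, hp, q, hq, Or.inl rfl⟩

theorem mul_mem_lcsProducts' {b j i i' : ℕ} (hi : i ≤ j) (h : i + i' = b + j) {p q : A}
    (hp : p ∈ lcs k A i) (hq : q ∈ lcs k A i') : q * p ∈ lcsProducts k A b j :=
  Submodule.subset_span ⟨i, i', hi, h, p, hp, q, hq, Or.inr rfl⟩

theorem commutator_mem_lcsProducts_succ (a : A) {b j : ℕ} {x : A}
    (hx : x ∈ lcsProducts k A b j) : a * x - x * a ∈ lcsProducts k A b (j + 1) := by
  induction hx using Submodule.span_induction with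
  | mem _ h =>
    obtain ⟨i, i', hi, h, p, hp, q, hq, rfl | rfl⟩ := h
    · convert add_mem
        (mul_mem_lcsProducts (b := b) (j := j + 1) (by omega) (by omega)
          (commutator_mem_lcs_succ a hp) hq)
        (mul_mem_lcsProducts (b := b) (j := j + 1) (by omega) (by omega)
          hp (commutator_mem_lcs_succ a hq)) using 1
      noncomm_ring
    · convert add_mem
        (mul_mem_lcsProducts' (b := b) (j := j + 1) (by omega) (by omega)
          (commutator_mem_lcs_succ a hp) hq)
        (mul_mem_lcsProducts' (b := b) (j := j + 1) (by omega) (by omega)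
          hp (commutator_mem_lcs_succ a hq)) using 1
      noncomm_ring
  | zero => simp
  | add u v _ _ hu hv =>
    convert add_mem hu hv using 1
    noncomm_ring
  | smul c u _ hu =>
    convert Submodule.smul_mem _ c hu using 1
    simp [smul_sub]

/-- Expanding `[c * d, w]` by the Leibniz rule and bracketing repeatedly moves `z * [d, w]` into
higher commutators, up to products whose left length is shorter than that of `z`. -/
theorem mul_commutator_mem_sup {b j : ℕ} (d : A) {w z : A} (hw : w ∈ lcs k A b)
    (hz : z ∈ lcs k A (j + 1)) :
    z * (d * w - w * d) ∈ lcs k A (b + 1 + j) ⊔ lcsProducts k A (b + 2) j := by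
  induction j generalizing z with
  | zero =>
    have h₁ := commutator_mem_lcs_succ (z * d) hw
    have h₂ : (z * w - w * z) * d ∈ lcsProducts k A (b + 2) 0 :=
      mul_mem_lcsProducts' le_rfl (by omega) (i := 0) (i' := 0 + 1 + b + 1) trivial
        (commutator_mem_lcs_add hz hw)
    convert sub_mem (Submodule.mem_sup_left h₁) (Submodule.mem_sup_right h₂) using 1
    noncomm_ring
  | succ j ih =>
    induction hz using Submodule.span_induction with
    | mem _ h =>
      obtain ⟨a, y, hy, rfl⟩ := h
      obtain ⟨s, hs, t, ht, hst⟩ := Submodule.mem_sup.1 (ih hy)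
      have h₁ : y * (a * (d * w - w * d) - (d * w - w * d) * a) ∈
          lcsProducts k A (b + 2) (j + 1) :=
        mul_mem_lcsProducts le_rfl (by omega) hy
          (commutator_mem_lcs_succ a (commutator_mem_lcs_succ d hw))
      rw [← add_assoc]
      convert sub_mem (add_mem (Submodule.mem_sup_left (commutator_mem_lcs_succ a hs))
        (Submodule.mem_sup_right (commutator_mem_lcsProducts_succ a ht)))
        (Submodule.mem_sup_right h₁) using 1
      rw [show a * s - s * a + (a * t - t * a) = a * (s + t) - (s + t) * a by noncomm_ring, hst]
      noncomm_ring
    | zero => simp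
    | add u v _ _ hu hv =>
      rw [add_mul]
      exact add_mem hu hv
    | smul c u _ hu =>
      rw [smul_mul_assoc]
      exact Submodule.smul_mem _ c hu

theorem lcs_mul_lcs_mem_idealGen {a b n : ℕ} (h : a + b = n + 1) {x y : A}
    (hx : x ∈ lcs k A a) (hy : y ∈ lcs k A b) :
    x * y ∈ idealGen k (lcs k A n : Set A) ∧ y * x ∈ idealGen k (lcs k A n : Set A) := by
  induction a using Nat.strong_induction_on generalizing b n x y with
  | _ a ih =>
  suffices hxy : x * y ∈ idealGen k (lcs k A n : Set A) by
    refine ⟨hxy, ?_⟩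
    have hc : x * y - y * x ∈ lcs k A n := lcs_antitone (by omega) (commutator_mem_lcs_add hx hy)
    simpa using sub_mem hxy (subset_idealGen (k := k) hc)
  rcases a with _ | a
  · exact mul_mem_idealGen x (subset_idealGen (lcs_antitone (by omega) hy))
  rcases b with _ | b
  · exact idealGen_mul_mem y (subset_idealGen (lcs_antitone (by omega) hx))
  have hle : lcs k A (b + 1 + a) ⊔ lcsProducts k A (b + 2) a ≤
      idealGen k (lcs k A n : Set A) := by
    refine sup_le (fun s hs => subset_idealGen (lcs_antitone (by omega) hs))
      (Submodule.span_le.2 ?_)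
    rintro _ ⟨i, i', hi, hii, p, hp, q, hq, rfl | rfl⟩
    · exact (ih i (by omega) (by omega) hp hq).1
    · exact (ih i (by omega) (by omega) hp hq).2
  induction hy using Submodule.span_induction with
  | mem _ h =>
    obtain ⟨d, w, hw, rfl⟩ := h
    exact hle (mul_commutator_mem_sup d hw hx)
  | zero => simp
  | add u v _ _ hu hv =>
    rw [mul_add]
    exact add_mem hu hv
  | smul c u _ hu =>
    rw [mul_smul_comm]
    exact Submodule.smul_mem _ c hu

end

/-- **Gupta–Levin.** For any associative unital algebra `A` over a field `k` and any
`m, l ≥ 2`, one has `M_m(A) · M_l(A) ⊆ M_{m+l-2}(A)`. -/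
theorem Mser_mul_Mser_le (k A : Type*) [Field k] [Ring A] [Algebra k A]
    (m l : ℕ) (hm : 2 ≤ m) (hl : 2 ≤ l) :
    Mser k A m * Mser k A l ≤ Mser k A (m + l - 2) := by
  unfold Mser Lser
  conv_lhs => unfold idealGen
  rw [Submodule.span_mul_span, Submodule.span_le]
  rintro _ ⟨_, ⟨a₁, b₁, s, hs, rfl⟩, _, ⟨a₂, b₂, t, ht, rfl⟩, rfl⟩
  have hmem : ∀ u ∈ lcs k A (m - 1), u * t ∈ idealGen k (lcs k A (m + l - 2 - 1) : Set A) :=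
    fun u hu => (lcs_mul_lcs_mem_idealGen (by omega) hu ht).1
  have hcomm := hmem _ (lcs_succ_le _ (commutator_mem_lcs_succ (b₁ * a₂) hs))
  have hmid := sub_mem (mul_mem_idealGen (b₁ * a₂) (hmem s hs)) hcomm
  rw [SetLike.mem_coe]
  convert idealGen_mul_mem b₂ (mul_mem_idealGen a₁ hmid) using 1
  noncomm_ring
end
end

section
/- For every associative unital ℂ-algebra A, one has M_2(A)·M_5(A) ⊆ M_6(A); that is, the pair (2,5) is null. -/
noncomputable section

section NilpotentCommutators

attribute [local instance] LieRing.ofAssociativeRing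

theorem eq_zero_of_swaps_of_cyclic {α M : Type*} [AddCommGroup M] [IsAddTorsionFree M]
    (K : α → α → α → α → M) (h12 : ∀ u d c v, K u d c v = -K d u c v)
    (h14 : ∀ u d c v, K u d c v = -K v d c u) (h34 : ∀ u d c v, K u d c v = -K u d v c)
    (hcyc : ∀ u d c v, K u d c v + K u c v d + K u v d c = 0) (u d c v : α) :
    K u d c v = 0 := by
  have e1 : ∀ u d c v, K u c v d = K u d c v := fun u d c v => by
    rw [h14 u c v d, h12 d c v u, h14 c d v u, h12 u d v c, h12 d u v c, h34 u d v c]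
    abel
  have h := hcyc u d c v
  rw [e1 u v d c, e1 u c v d, e1] at h
  have h3 : 3 • K u d c v = 0 := by rw [← h]; abel
  simpa using h3

theorem eq_zero_of_swaps_of_four_term {α M : Type*} [AddCommGroup M] [IsAddTorsionFree M]
    (N : α → α → α → α → α → α → α → M)
    (h12 : ∀ a b c v x y d, N a b c v x y d = -N b a c v x y d)
    (h13 : ∀ a b c v x y d, N a b c v x y d = -N c b a v x y d)
    (h24 : ∀ a b c v x y d, N a b c v x y d = -N a v c b x y d)
    (h26 : ∀ a b c v x y d, N a b c v x y d = -N a y c v x b d)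
    (h56 : ∀ a b c v x y d, N a b c v x y d = -N a b c v y x d)
    (h4 : ∀ a b c v x y d,
      N a b c v x y d - N a b c d x y v + N a b c y d v x - N a b c x d v y = 0)
    (a b c v x y d : α) : N a b c v x y d = 0 := by
  have h14 a b c v x y d : N a b c v x y d = -N v b c a x y d := by
    rw [h12, h24, h12, neg_neg]
  have h34 a b c v x y d : N a b c v x y d = -N a b v c x y d := by
    rw [h13, h14, h13, neg_neg]
  have h23 a b c v x y d : N a b c v x y d = -N a c b v x y d := by
    rw [h12, h13, h12, neg_neg]
  have h36 a b c v x y d : N a b c v x y d = -N a b y v x c d := by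
    rw [h23, h26, h23, neg_neg]
  have h35 a b c v x y d : N a b c v x y d = -N a b x v c y d := by
    rw [h56, h36, h56, neg_neg]
  have h46 a b c v x y d : N a b c v x y d = -N a b c y x v d := by
    rw [h34, h36, h34, neg_neg]
  have h37 a b c v x y d : N a b c v x y d = -N a b d v x y c := by
    have h := h4 a b d v x y c
    rw [h34 a b d c, h35 a b d y, h35 a b d x] at h
    linear_combination (norm := abel) h4 a b c v x y d + h
  have h47 a b c v x y d : N a b c v x y d = -N a b c d x y v := by
    rw [h34, h37, h34, neg_neg]
  have h57 a b c v x y d : N a b c v x y d = -N a b c v d y x := by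
    rw [h35, h37, h35, neg_neg]
  have h := h4 a b c v x y d
  rw [h47 a b c d x y v, h47 a b c x d v y, h57 a b c y d v x, h46 a b c y x v d] at h
  have h4N : 4 • N a b c v x y d = 0 := by rw [← h]; abel
  simpa using h4N

variable {B : Type*} [Ring B]

theorem lie_mul_eq (p u v : B) : ⁅p, u * v⁆ = ⁅p, u⁆ * v + u * ⁅p, v⁆ := by
  simp only [Ring.lie_def]; noncomm_ring

theorem mul_lie_eq (p u v : B) : ⁅u * v, p⁆ = ⁅u, p⁆ * v + u * ⁅v, p⁆ := by
  simp only [Ring.lie_def]; noncomm_ring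

theorem mul_comm_of_lie_eq_zero {x y : B} (h : ⁅x, y⁆ = 0) : x * y = y * x :=
  sub_eq_zero.mp h

/-- If `⁅A, ⁅A, P⁆⁆ = 0`, then `⁅c, u⁆ * ⁅v, P⁆` is antisymmetric in `u` and `v`. -/
theorem lie_mul_lie_swap {P : B} (hP : ∀ x y : B, ⁅x, ⁅y, P⁆⁆ = 0) (c u v : B) :
    ⁅c, u⁆ * ⁅v, P⁆ = -(⁅c, v⁆ * ⁅u, P⁆) := by
  have h : ⁅c, ⁅u * v, P⁆⁆ = 0 := hP _ _
  have hc : ⁅u, P⁆ * ⁅c, v⁆ = ⁅c, v⁆ * ⁅u, P⁆ :=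
    (mul_comm_of_lie_eq_zero (hP _ _)).symm
  simp only [lie_mul_eq, mul_lie_eq, lie_add, hP, zero_mul, mul_zero, zero_add, add_zero, hc] at h
  linear_combination (norm := abel) h

/-- If `⁅A, ⁅A, P⁆⁆ = 0`, then `⁅c, u⁆ * ⁅v, P⁆` is antisymmetric in `c` and `v`. -/
theorem lie_mul_lie_swap' {P : B} (hP : ∀ x y : B, ⁅x, ⁅y, P⁆⁆ = 0) (c u v : B) :
    ⁅c, u⁆ * ⁅v, P⁆ = -(⁅v, u⁆ * ⁅c, P⁆) := by
  rw [← lie_skew, neg_mul, lie_mul_lie_swap hP, ← lie_skew v, neg_mul]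

/-- For `Y ∈ L_3`, the product `⁅u, Y⁆ * ⁅d, ⁅c, v⁆⁆` is antisymmetric in `u` and `v`. -/
theorem lie_mul_lie_lie_swap {Y : B} (hY : ∀ x y z : B, ⁅x, ⁅y, ⁅z, Y⁆⁆⁆ = 0) (u d c v : B) :
    ⁅u, Y⁆ * ⁅d, ⁅c, v⁆⁆ = -(⁅v, Y⁆ * ⁅d, ⁅c, u⁆⁆) := by
  have h : ⁅d, ⁅c, ⁅u * v, Y⁆⁆⁆ = 0 := hY _ _ _
  have hc : ⁅d, ⁅c, u⁆⁆ * ⁅v, Y⁆ = ⁅v, Y⁆ * ⁅d, ⁅c, u⁆⁆ :=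
    mul_comm_of_lie_eq_zero (by simp only [lie_lie, hY, sub_zero, lie_zero])
  have hcen : ∀ x y z : B, ⁅y, ⁅x, Y⁆⁆ * z = z * ⁅y, ⁅x, Y⁆⁆ := fun x y z =>
    (mul_comm_of_lie_eq_zero (hY _ _ _)).symm
  simp only [lie_mul_eq, mul_lie_eq, lie_add, hY, mul_zero, add_zero, hc, hcen]
    at h
  have h1 := lie_mul_lie_swap' (hY · · u) d v c
  have h2 := lie_mul_lie_swap' (hY · · v) d u c
  linear_combination (norm := abel) h - h1 - h2

/-- For `Y ∈ L_3`, the product `⁅u, Y⁆ * ⁅v, ⁅c, e⁆⁆` is antisymmetric in `u` and `v`. -/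
theorem lie_mul_lie_lie_swap' {Y : B} (hY : ∀ x y z : B, ⁅x, ⁅y, ⁅z, Y⁆⁆⁆ = 0) (u v c e : B) :
    ⁅u, Y⁆ * ⁅v, ⁅c, e⁆⁆ = -(⁅v, Y⁆ * ⁅u, ⁅c, e⁆⁆) := by
  have hz : ∀ w : B, ⁅⁅c, e⁆, ⁅w, Y⁆⁆ = 0 := fun w => by simp only [lie_lie, hY, sub_zero]
  have h := hz (u * v)
  have hc : ⁅u, ⁅c, e⁆⁆ * ⁅v, Y⁆ = ⁅v, Y⁆ * ⁅u, ⁅c, e⁆⁆ :=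
    mul_comm_of_lie_eq_zero (by simp only [lie_lie, hY, sub_zero, lie_zero])
  simp only [lie_mul_eq, mul_lie_eq, lie_add, ← lie_skew ⁅c, e⁆ u, ← lie_skew ⁅c, e⁆ v,
    neg_mul, mul_neg, hz, zero_mul, mul_zero, zero_add, add_zero, hc] at h
  linear_combination (norm := abel) -h

/-- `L_4 * L_3 = 0` in a ring with `L_6 = 0`. -/
theorem lie_mul_lie_lie_eq_zero [IsAddTorsionFree B] {Y : B}
    (hY : ∀ x y z : B, ⁅x, ⁅y, ⁅z, Y⁆⁆⁆ = 0) (u d c v : B) : ⁅u, Y⁆ * ⁅d, ⁅c, v⁆⁆ = 0 := by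
  refine eq_zero_of_swaps_of_cyclic (fun u d c v : B => ⁅u, Y⁆ * ⁅d, ⁅c, v⁆⁆)
    (lie_mul_lie_lie_swap' hY) (lie_mul_lie_lie_swap hY) (fun u d c v => ?_)
    (fun u d c v => ?_) u d c v
  · rw [← lie_skew c v, lie_neg, mul_neg]
  · rw [← mul_add, ← mul_add, lie_jacobi, mul_zero]

section

variable (h6 : ∀ a b c d e f : B, ⁅a, ⁅b, ⁅c, ⁅d, ⁅e, f⁆⁆⁆⁆⁆ = 0)
  (h43 : ∀ a b c d x y z : B, ⁅a, ⁅b, ⁅c, d⁆⁆⁆ * ⁅x, ⁅y, z⁆⁆ = 0)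
  (h34 : ∀ a b c d x y z : B, ⁅x, ⁅y, z⁆⁆ * ⁅a, ⁅b, ⁅c, d⁆⁆⁆ = 0)
include h6 h43 h34

/-- Expansion of `⁅e, ⁅d, ⁅c, ⁅u * v, ⁅r, s⁆⁆⁆⁆⁆ = 0`. -/
theorem lie_mul_lie_lie_lie_swap (c u e d v r s : B) :
    ⁅c, u⁆ * ⁅e, ⁅d, ⁅v, ⁅r, s⁆⁆⁆⁆ = -(⁅c, v⁆ * ⁅e, ⁅d, ⁅u, ⁅r, s⁆⁆⁆⁆) := by
  have h := h6 e d c (u * v) r s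
  have hcen : ∀ x y z r s p q : B,
      ⁅x, ⁅y, ⁅z, ⁅r, s⁆⁆⁆⁆ * ⁅p, q⁆ = ⁅p, q⁆ * ⁅x, ⁅y, ⁅z, ⁅r, s⁆⁆⁆⁆ := fun x y z r s p q =>
    (mul_comm_of_lie_eq_zero (h6 _ _ _ _ _ _)).symm
  simp only [lie_mul_eq, mul_lie_eq, lie_add, h6, h34, h43,
    zero_mul, mul_zero, zero_add, add_zero, hcen] at h
  have h1 := lie_mul_lie_swap' (fun x y => h6 x y c u r s) d v e
  have h2 := lie_mul_lie_swap' (fun x y => h6 x y c v r s) d u e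
  linear_combination (norm := abel) h - h1 - h2

theorem lie_mul_lie_lie_lie_swap' (c u g e v d f : B) :
    ⁅c, u⁆ * ⁅g, ⁅f, ⁅e, ⁅d, v⁆⁆⁆⁆ = -(⁅c, v⁆ * ⁅g, ⁅f, ⁅e, ⁅d, u⁆⁆⁆⁆) := by
  have h : ⁅g, ⁅f, ⁅e, ⁅d, ⁅c, u * v⁆⁆⁆⁆⁆ = 0 := h6 _ _ _ _ _ _
  have hcen : ∀ x y z r s p q : B,
      ⁅x, ⁅y, ⁅z, ⁅r, s⁆⁆⁆⁆ * ⁅p, q⁆ = ⁅p, q⁆ * ⁅x, ⁅y, ⁅z, ⁅r, s⁆⁆⁆⁆ := fun x y z r s p q =>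
    (mul_comm_of_lie_eq_zero (h6 _ _ _ _ _ _)).symm
  simp only [lie_mul_eq, lie_add, h6, h34, h43,
    zero_mul, mul_zero, zero_add, add_zero, hcen] at h
  have key : ∀ u v : B, ⁅d, u⁆ * ⁅g, ⁅f, ⁅e, ⁅c, v⁆⁆⁆⁆ = -(⁅e, u⁆ * ⁅g, ⁅f, ⁅d, ⁅c, v⁆⁆⁆⁆) := by
    intro u v
    rw [← lie_skew d u, neg_mul, lie_mul_lie_lie_lie_swap h6 h43 h34, ← lie_skew e u, neg_mul]
  have h1 := lie_mul_lie_swap' (fun x y => h6 x y e d c u) g v f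
  have h2 := lie_mul_lie_swap' (fun x y => h6 x y e d c v) g u f
  linear_combination (norm := abel) h - h1 - h2 - key u v - key v u

theorem lie_mul_lie_lie_lie_eq_zero [IsAddTorsionFree B] (a b c d v x y : B) :
    ⁅a, b⁆ * ⁅c, ⁅d, ⁅v, ⁅x, y⁆⁆⁆⁆ = 0 := by
  refine eq_zero_of_swaps_of_four_term
    (fun a b c v x y d : B => ⁅a, b⁆ * ⁅c, ⁅d, ⁅v, ⁅x, y⁆⁆⁆⁆)
    (fun a b c v x y d => ?_) (fun a b c v x y d => lie_mul_lie_swap' (h6 · · _ _ _ _) a b c)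
    (fun a b c v x y d => lie_mul_lie_lie_lie_swap h6 h43 h34 a b c d v x y)
    (fun a b c v x y d => lie_mul_lie_lie_lie_swap' h6 h43 h34 a b c v y x d)
    (fun a b c v x y d => ?_) (fun a b c v x y d => ?_) a b c v x y d
  · rw [← lie_skew a b, neg_mul]
  · rw [← lie_skew x y, lie_neg, lie_neg, lie_neg, mul_neg]
  · have hxy : ⁅d, ⁅v, ⁅x, y⁆⁆⁆ - ⁅v, ⁅d, ⁅x, y⁆⁆⁆ + ⁅x, ⁅y, ⁅d, v⁆⁆⁆ - ⁅y, ⁅x, ⁅d, v⁆⁆⁆ = 0 := by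
      rw [← lie_lie, add_sub_assoc, ← lie_lie, ← lie_skew, neg_add_cancel]
    rw [← mul_sub, ← mul_add, ← mul_sub, ← lie_sub, ← lie_add, ← lie_sub, hxy, lie_zero, mul_zero]

end

/-- `L_2 * L_5 = 0` in a ring with `L_6 = 0` and torsion-free additive group. -/
theorem lie_mul_lie_eq_zero_of_lie_eq_zero [IsAddTorsionFree B]
    (h6 : ∀ a b c d e f : B, ⁅a, ⁅b, ⁅c, ⁅d, ⁅e, f⁆⁆⁆⁆⁆ = 0) (a b c d v x y : B) :
    ⁅a, b⁆ * ⁅c, ⁅d, ⁅v, ⁅x, y⁆⁆⁆⁆ = 0 := by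
  have h43 : ∀ a b c d x y z : B, ⁅a, ⁅b, ⁅c, d⁆⁆⁆ * ⁅x, ⁅y, z⁆⁆ = 0 := fun a b c d =>
    lie_mul_lie_lie_eq_zero (h6 · · · b c d) a
  refine lie_mul_lie_lie_lie_eq_zero h6 h43 (fun a b c d x y z => ?_) a b c d v x y
  rw [mul_comm_of_lie_eq_zero, h43]
  simp only [lie_lie, h6, sub_zero, lie_zero]

end NilpotentCommutators

section LowerCentralSeries

variable {k A : Type*} [Field k] [Ring A] [Algebra k A]

theorem mem_Mser_of_mem_Lser {i : ℕ} {x : A} (hx : x ∈ Lser k A i) : x ∈ Mser k A i :=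
  Submodule.subset_span ⟨1, 1, x, hx, by simp⟩

theorem mul_mem_Mser_left {i : ℕ} (r : A) {x : A} (hx : x ∈ Mser k A i) : r * x ∈ Mser k A i := by
  induction hx using Submodule.span_induction with
  | mem x hx =>
    obtain ⟨a, b, s, hs, rfl⟩ := hx
    exact Submodule.subset_span ⟨r * a, b, s, hs, by simp only [mul_assoc]⟩
  | zero => simp
  | add x y _ _ hx hy => rw [mul_add]; exact add_mem hx hy
  | smul t x _ hx => rw [mul_smul_comm]; exact Submodule.smul_mem _ t hx

theorem mul_mem_Mser_right {i : ℕ} (r : A) {x : A} (hx : x ∈ Mser k A i) :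
    x * r ∈ Mser k A i := by
  induction hx using Submodule.span_induction with
  | mem x hx =>
    obtain ⟨a, b, s, hs, rfl⟩ := hx
    exact Submodule.subset_span ⟨a, b * r, s, hs, by simp only [mul_assoc]⟩
  | zero => simp
  | add x y _ _ hx hy => rw [add_mul]; exact add_mem hx hy
  | smul t x _ hx => rw [smul_mul_assoc]; exact Submodule.smul_mem _ t hx

variable (k A) in
/-- `M_i(A)` as a `TwoSidedIdeal`. -/
def MserIdeal (i : ℕ) : TwoSidedIdeal A :=
  .mk' (Mser k A i) (zero_mem _) add_mem neg_mem (mul_mem_Mser_left _) (mul_mem_Mser_right _)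

theorem mk_eq_zero_iff_mem_Mser {i : ℕ} {x : A} :
    (MserIdeal k A i).ringCon.mk' x = 0 ↔ x ∈ Mser k A i := by
  rw [← TwoSidedIdeal.mem_ker, TwoSidedIdeal.ker_ringCon_mk']
  exact TwoSidedIdeal.mem_mk' ..

theorem lie_mem_lcs_succ {n : ℕ} (a : A) {b : A} (hb : b ∈ lcs k A n) :
    a * b - b * a ∈ lcs k A (n + 1) :=
  Submodule.subset_span ⟨a, b, hb, rfl⟩

/-- `L_{n+1}(A)` is contained in the span of the right-normed commutators of length `n + 1`. -/
theorem lcs_le_span_iterate (n : ℕ) :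
    lcs k A n ≤ Submodule.span k ((Set.image2 (⁅·, ·⁆ : A → A → A) Set.univ)^[n] Set.univ) := by
  induction n with
  | zero => simp [lcs]
  | succ n ih =>
    rw [Function.iterate_succ_apply']
    refine Submodule.span_le.mpr ?_
    rintro _ ⟨a, b, hb, rfl⟩
    replace hb := ih hb
    rw [SetLike.mem_coe]
    induction hb using Submodule.span_induction with
    | mem b hb => exact Submodule.subset_span ⟨a, trivial, b, hb, rfl⟩
    | zero => simp
    | add x y _ _ hx hy =>
      rw [mul_add, add_mul, add_sub_add_comm]
      exact add_mem hx hy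
    | smul t x _ hx =>
      rw [mul_smul_comm, smul_mul_assoc, ← smul_sub]
      exact Submodule.smul_mem _ t hx

theorem mul_eq_zero_of_forall_mem {B : Type*} [Ring B] [Algebra k B] (f : A →ₐ[k] B) {S T : Set A}
    (h : ∀ s ∈ S, ∀ t ∈ T, f s * f t = 0) {s t : A} (hs : s ∈ Submodule.span k S)
    (ht : t ∈ Submodule.span k T) : f s * f t = 0 := by
  induction hs, ht using Submodule.span_induction₂ with
  | mem_mem x y hx hy => exact h x hx y hy
  | zero_left y hy => simp
  | zero_right x hx => simp
  | add_left x y z _ _ _ h1 h2 => rw [map_add, add_mul, h1, h2, add_zero]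
  | add_right x y z _ _ _ h1 h2 => rw [map_add, mul_add, h1, h2, add_zero]
  | smul_left r x y _ _ h => rw [map_smul, smul_mul_assoc, h, smul_zero]
  | smul_right r x y _ _ h => rw [map_smul, mul_smul_comm, h, smul_zero]

/-- The pair `(2, 5)` is null over every field of characteristic zero. -/
theorem Mser_mul_Mser_le_s5 [CharZero k] : Mser k A 2 * Mser k A 5 ≤ Mser k A 6 := by
  let I := (MserIdeal k A 6).ringCon
  let f : A →ₐ[k] I.Quotient := { I.mk' with commutes' := fun _ => rfl }
  have hf : ∀ x, f x = 0 ↔ x ∈ Mser k A 6 := fun x => mk_eq_zero_iff_mem_Mser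
  have hsurj : Function.Surjective f := I.mk'_surjective
  have hlie : ∀ x y, f ⁅x, y⁆ = ⁅f x, f y⁆ := fun x y => by simp [Ring.lie_def]
  have : IsAddTorsionFree I.Quotient :=
    letI : Module ℚ I.Quotient := Module.compHom _ (algebraMap ℚ k)
    .of_module_rat _
  have h6 : ∀ a b c d e f : I.Quotient, ⁅a, ⁅b, ⁅c, ⁅d, ⁅e, f⁆⁆⁆⁆⁆ = 0 := by
    simp_rw [hsurj.forall, ← hlie, hf]
    intro a b c d e f
    exact mem_Mser_of_mem_Lser <| lie_mem_lcs_succ _ <| lie_mem_lcs_succ _ <|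
      lie_mem_lcs_succ _ <| lie_mem_lcs_succ _ <| lie_mem_lcs_succ _ Submodule.mem_top
  have h25 : ∀ s ∈ Lser k A 2, ∀ t ∈ Lser k A 5, f s * f t = 0 := by
    refine fun s hs t ht => mul_eq_zero_of_forall_mem f ?_
      (lcs_le_span_iterate 1 hs) (lcs_le_span_iterate 4 ht)
    rintro _ ⟨a, -, b, -, rfl⟩ _ ⟨c, -, _, ⟨d, -, _, ⟨v, -, _, ⟨x, -, y, -, rfl⟩, rfl⟩, rfl⟩, rfl⟩
    simpa only [hlie] using lie_mul_lie_eq_zero_of_lie_eq_zero h6 ..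
  rw [Submodule.mul_le]
  intro x hx y hy
  rw [← hf, map_mul]
  refine mul_eq_zero_of_forall_mem f ?_ hx hy
  rintro _ ⟨a, b, s, hs, rfl⟩ _ ⟨a', b', t, ht, rfl⟩
  have hcomm : f (b * a') * f t = f t * f (b * a') := by
    rw [← sub_eq_zero, ← map_mul, ← map_mul, ← map_sub, hf]
    exact mem_Mser_of_mem_Lser (lie_mem_lcs_succ _ ht)
  calc f (a * s * b) * f (a' * t * b') = f a * f s * (f (b * a') * f t) * f b' := by
        simp only [map_mul, mul_assoc]
    _ = f a * (f s * f t) * f (b * a') * f b' := by rw [hcomm]; simp only [mul_assoc]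
    _ = 0 := by rw [h25 s hs t ht]; simp

end LowerCentralSeries

/-- For every associative unital `ℂ`-algebra `A`, one has `M_2(A) · M_5(A) ⊆ M_6(A)`;
that is, the pair (2, 5) is null. -/
theorem Mser_2_mul_Mser_5 (A : Type*) [Ring A] [Algebra ℂ A] :
    Mser ℂ A 2 * Mser ℂ A 5 ≤ Mser ℂ A 6 :=
  Mser_mul_Mser_le_s5
end
end

section
/- The pair (2,2) is not null: in the free associative unital ℂ-algebra A_4 on generators x_1, x_2, x_3, x_4, the element [x_1,x_2]·[x_3,x_4] does not belong to M_3(A_4). -/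
noncomputable section

/-- The commutator `[a, b] = a*b - b*a`. -/
def ringComm {A : Type*} [Ring A] (a b : A) : A := a * b - b * a

section ExteriorCommutators

variable {R M : Type*} [CommRing R] [AddCommGroup M] [Module R M]

namespace ExteriorAlgebra

theorem ι_mul_ι_eq_neg (m n : M) : ι R m * ι R n = -(ι R n * ι R m) :=
  eq_neg_of_add_eq_zero_left (ι_add_mul_swap m n)

theorem ι_mul_ι_mem_center (m n : M) :
    ι R m * ι R n ∈ Subalgebra.center R (ExteriorAlgebra R M) := by
  rw [Subalgebra.mem_center_iff]
  intro x
  induction x using ExteriorAlgebra.induction with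
  | algebraMap r => exact Algebra.commutes r _
  | ι p =>
    rw [← mul_assoc, ι_mul_ι_eq_neg p m, neg_mul, mul_assoc, ι_mul_ι_eq_neg p n, mul_neg,
      neg_neg, mul_assoc]
  | mul a b ha hb => rw [mul_assoc, hb, ← mul_assoc, ha, mul_assoc]
  | add a b ha hb => rw [add_mul, mul_add, ha, hb]

/-- The exterior algebra is spanned over its center by `1` and the degree one vectors. -/
theorem span_center_mul_eq_top :
    Submodule.span R {x : ExteriorAlgebra R M |
      ∃ z ∈ Subalgebra.center R (ExteriorAlgebra R M),
        x = z ∨ ∃ m, x = z * ι R m} = ⊤ := by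
  rw [eq_top_iff]
  rintro x -
  induction x using CliffordAlgebra.left_induction with
  | algebraMap r => exact Submodule.subset_span ⟨_, Subalgebra.algebraMap_mem _ r, Or.inl rfl⟩
  | add x y hx hy => exact add_mem hx hy
  | ι_mul x m hx =>
    induction hx using Submodule.span_induction with
    | zero => simp
    | add a b _ _ ha hb => rw [mul_add]; exact add_mem ha hb
    | smul r a _ ha => rw [mul_smul_comm]; exact Submodule.smul_mem _ r ha
    | mem a ha =>
      obtain ⟨z, hz, rfl | ⟨n, rfl⟩⟩ := ha
      · exact Submodule.subset_span ⟨_, hz, Or.inr ⟨m, Subalgebra.mem_center_iff.1 hz _⟩⟩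
      · refine Submodule.subset_span ⟨_, mul_mem hz (ι_mul_ι_mem_center m n), Or.inl ?_⟩
        rw [← mul_assoc, ← mul_assoc, ← Subalgebra.mem_center_iff.1 hz]

theorem commutator_mem_center (a b : ExteriorAlgebra R M) :
    a * b - b * a ∈ Subalgebra.center R (ExteriorAlgebra R M) := by
  have ha := (span_center_mul_eq_top (R := R) (M := M)).ge (Submodule.mem_top (x := a))
  have hb := (span_center_mul_eq_top (R := R) (M := M)).ge (Submodule.mem_top (x := b))
  induction ha, hb using Submodule.span_induction₂ with
  | zero_left => simp
  | zero_right => simp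
  | add_left x y z _ _ _ hx hy =>
    convert add_mem hx hy using 1
    noncomm_ring
  | add_right x y z _ _ _ hx hy =>
    convert add_mem hx hy using 1
    noncomm_ring
  | smul_left r x y _ _ h =>
    convert Subalgebra.smul_mem _ h r using 1
    simp [smul_sub]
  | smul_right r x y _ _ h =>
    convert Subalgebra.smul_mem _ h r using 1
    simp [smul_sub]
  | mem_mem x y hx hy =>
    obtain ⟨z, hz, rfl | ⟨m, rfl⟩⟩ := hx
    · rw [Subalgebra.mem_center_iff.1 hz, sub_self]
      exact zero_mem _
    obtain ⟨w, hw, rfl | ⟨n, rfl⟩⟩ := hy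
    · rw [Subalgebra.mem_center_iff.1 hw, sub_self]
      exact zero_mem _
    have hzc := Subalgebra.mem_center_iff.1 hz
    have hwc := Subalgebra.mem_center_iff.1 hw
    have h : z * ι R m * (w * ι R n) - w * ι R n * (z * ι R m) =
        z * w * (ι R m * ι R n - ι R n * ι R m) := by
      rw [mul_sub]
      congr 1
      · rw [mul_assoc, ← mul_assoc (ι R m), hwc, mul_assoc, mul_assoc]
      · rw [mul_assoc, ← mul_assoc (ι R n), hzc, mul_assoc z, ← mul_assoc w, ← hwc z]
    rw [h]
    exact mul_mem (mul_mem hz hw) (sub_mem (ι_mul_ι_mem_center m n) (ι_mul_ι_mem_center n m))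

theorem ι_mul_ι_sub_swap (m n : M) :
    ι R m * ι R n - ι R n * ι R m = (2 : R) • (ι R m * ι R n) := by
  rw [ι_mul_ι_eq_neg n m, sub_neg_eq_add, two_smul]

theorem ιMulti_piSingle_ne_zero [Nontrivial R] (n : ℕ) :
    ιMulti R n (fun i : Fin n => (Pi.single i 1 : Fin n → R)) ≠ 0 := by
  intro h
  have h' := liftAlternating_apply_ιMulti (R := R)
    (Pi.single n (Matrix.detRowAlternating (n := Fin n) (R := R)))
    (fun i : Fin n => (Pi.single i 1 : Fin n → R))
  rw [h, map_zero, Pi.single_eq_same] at h'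
  have h1 : Matrix.detRowAlternating (fun i : Fin n => (Pi.single i 1 : Fin n → R)) = 1 := by
    have : (fun i : Fin n => (Pi.single i 1 : Fin n → R)) = (1 : Matrix (Fin n) (Fin n) R) := by
      ext i j
      simp [Matrix.one_apply, Pi.single_apply, eq_comm]
    rw [this]
    exact Matrix.det_one
  exact one_ne_zero (h1.symm.trans h'.symm)

end ExteriorAlgebra

end ExteriorCommutators

/-- A homomorphism to an algebra whose commutators are all central kills `M_3`. -/
theorem map_eq_zero_of_mem_Mser_three {k A B : Type*} [Field k] [Ring A] [Algebra k A]
    [Ring B] [Algebra k B] (hB : ∀ a b : B, a * b - b * a ∈ Subalgebra.center k B)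
    (f : A →ₐ[k] B) {x : A} (hx : x ∈ Mser k A 3) : f x = 0 := by
  have h2 : lcs k A 1 ≤ (Subalgebra.toSubmodule (Subalgebra.center k B)).comap f.toLinearMap := by
    refine Submodule.span_le.2 ?_
    rintro _ ⟨a, b, -, rfl⟩
    simpa only [Submodule.comap_coe, Set.mem_preimage, SetLike.mem_coe,
      Subalgebra.mem_toSubmodule, AlgHom.toLinearMap_apply, map_sub, map_mul]
      using hB (f a) (f b)
  have h3 : lcs k A 2 ≤ LinearMap.ker f.toLinearMap := by
    refine Submodule.span_le.2 ?_
    rintro _ ⟨a, b, hb, rfl⟩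
    have := Subalgebra.mem_center_iff (R := k).1 (h2 hb) (f a)
    simpa [sub_eq_zero] using this
  have h : Mser k A 3 ≤ LinearMap.ker f.toLinearMap := by
    refine Submodule.span_le.2 ?_
    rintro _ ⟨a, b, s, hs, rfl⟩
    have : f s = 0 := h3 hs
    simp [this]
  exact h hx

/-- The pair (2,2) is not null: in the free associative unital `ℂ`-algebra on four
generators, the element `[x_1,x_2] · [x_3,x_4]` does not belong to `M_3`. -/
theorem pair_two_two_not_null :
    ringComm (FreeAlgebra.ι ℂ (0 : Fin 4)) (FreeAlgebra.ι ℂ (1 : Fin 4)) *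
      ringComm (FreeAlgebra.ι ℂ (2 : Fin 4)) (FreeAlgebra.ι ℂ (3 : Fin 4)) ∉
        Mser ℂ (FreeAlgebra ℂ (Fin 4)) 3 := by
  intro hx
  have h := map_eq_zero_of_mem_Mser_three ExteriorAlgebra.commutator_mem_center
    (FreeAlgebra.lift ℂ fun i : Fin 4 =>
      ExteriorAlgebra.ι ℂ (Pi.single i 1 : Fin 4 → ℂ)) hx
  simp only [ringComm, map_mul, map_sub, FreeAlgebra.lift_ι_apply,
    ExteriorAlgebra.ι_mul_ι_sub_swap, smul_mul_smul_comm] at h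
  refine ExteriorAlgebra.ιMulti_piSingle_ne_zero (R := ℂ) 4 ?_
  have h4 := (smul_eq_zero.1 h).resolve_left (by norm_num)
  rw [mul_assoc] at h4
  simp only [ExteriorAlgebra.ιMulti_apply, List.ofFn_succ, List.ofFn_zero, List.prod_cons,
    List.prod_nil, mul_one]
  exact h4
end
end

section
/- The pair (2,4) is not null: in the free associative unital ℂ-algebra A_6 on generators x_1,…,x_6, the element [x_1,x_2]·[[[x_3,x_4],x_5],x_6] does not belong to M_5(A_6). -/
noncomputable section

open scoped TensorProduct Quaternion

/-- A filtration, compatible with commutators, of the target of an algebra homomorphism bounds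
the image of the lower central series. -/
theorem map_mem_of_mem_lcs {k A B : Type*} [Field k] [Ring A] [Algebra k A] [Ring B] [Algebra k B]
    (f : A →ₐ[k] B) (S : ℕ → Submodule k B) (hzero : S 0 = ⊤)
    (hsucc : ∀ n, ∀ a, ∀ b ∈ S n, a * b - b * a ∈ S (n + 1)) (n : ℕ) :
    ∀ x ∈ lcs k A n, f x ∈ S n := by
  induction n with
  | zero => intro x _; simp [hzero]
  | succ n ih =>
    intro x hx
    have hle : lcs k A (n + 1) ≤ (S (n + 1)).comap f.toLinearMap := by
      refine Submodule.span_le.2 ?_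
      rintro _ ⟨a, b, hb, rfl⟩
      simpa using hsucc n (f a) (f b) (ih b hb)
    exact hle hx

/-- If the terms of the lower central series of index `i` map to zero, so does the ideal they
generate. -/
theorem map_eq_zero_of_mem_Mser {k A B : Type*} [Field k] [Ring A] [Algebra k A] [Ring B]
    [Algebra k B] (f : A →ₐ[k] B) (i : ℕ) (h : ∀ x ∈ Lser k A i, f x = 0) :
    ∀ x ∈ Mser k A i, f x = 0 := by
  intro x hx
  have hle : Mser k A i ≤ LinearMap.ker f.toLinearMap := by
    refine Submodule.span_le.2 ?_
    rintro _ ⟨a, b, s, hs, rfl⟩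
    simp [h s hs]
  exact hle hx

section Exterior

variable {M : Type*} [AddCommGroup M] [Module ℂ M]

/-- The even (`p = 0`) and odd (`p = 1`) parts of an exterior algebra. -/
abbrev extPart (M : Type*) [AddCommGroup M] [Module ℂ M] (p : ZMod 2) :
    Submodule ℂ (ExteriorAlgebra ℂ M) :=
  CliffordAlgebra.evenOdd (0 : QuadraticForm ℂ M) p

theorem extPart_mul_mem {p q : ZMod 2} {u v : ExteriorAlgebra ℂ M} (hu : u ∈ extPart M p)
    (hv : v ∈ extPart M q) : u * v ∈ extPart M (p + q) :=
  SetLike.mul_mem_graded hu hv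

theorem extPart_mul_comm {p q : ZMod 2} {u v : ExteriorAlgebra ℂ M} (hu : u ∈ extPart M p)
    (hv : v ∈ extPart M q) : u * v = (-1 : ℤˣ) ^ (q * p) • (v * u) := by
  have h := CliffordAlgebra.map_mul_map_of_isOrtho_of_mem_evenOdd
    (QuadraticMap.Isometry.id (0 : QuadraticForm ℂ M)) (QuadraticMap.Isometry.id _)
    (fun x y => by simp [QuadraticMap.IsOrtho]) u v hu hv
  simpa using h

theorem extPart_sup : extPart M 0 ⊔ extPart M 1 = ⊤ :=
  (CliffordAlgebra.evenOdd_isCompl _).sup_eq_top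

theorem ι_mem_extPart_one (m : M) : ExteriorAlgebra.ι ℂ m ∈ extPart M 1 :=
  CliffordAlgebra.ι_mem_evenOdd_one _ m

theorem ι_mul_ι_mem_extPart_zero (m m' : M) :
    ExteriorAlgebra.ι ℂ m * ExteriorAlgebra.ι ℂ m' ∈ extPart M 0 :=
  CliffordAlgebra.ι_mul_ι_mem_evenOdd_zero _ m m'

end Exterior

/-- The exterior algebra on two generators `i`, `j`, presented as a degenerate quaternion
algebra. -/
abbrev DegQuat : Type := ℍ[ℂ,0,0,0]

/-- The span of `1` and `k`. -/
def quatEven : Submodule ℂ DegQuat where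
  carrier := {v | v.imI = 0 ∧ v.imJ = 0}
  zero_mem' := by simp
  add_mem' := by rintro a b ⟨h, hb⟩ ⟨g, gb⟩; simp [h, hb, g, gb]
  smul_mem' := by rintro c a ⟨h, hb⟩; simp [h, hb]

/-- The span of `i` and `j`. -/
def quatOdd : Submodule ℂ DegQuat where
  carrier := {v | v.re = 0 ∧ v.imK = 0}
  zero_mem' := by simp
  add_mem' := by rintro a b ⟨h, hb⟩ ⟨g, gb⟩; simp [h, hb, g, gb]
  smul_mem' := by rintro c a ⟨h, hb⟩; simp [h, hb]

/-- The span of `k`. -/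
def quatTop : Submodule ℂ DegQuat where
  carrier := {v | v.re = 0 ∧ v.imI = 0 ∧ v.imJ = 0}
  zero_mem' := by simp
  add_mem' := by rintro a b ⟨h, hb, hc⟩ ⟨g, gb, gc⟩; simp [h, hb, hc, g, gb, gc]
  smul_mem' := by rintro c a ⟨h, hb, hc⟩; simp [h, hb, hc]

theorem quatTop_le_quatEven : quatTop ≤ quatEven := fun _ h => h.2

theorem quatEven_sup_quatOdd : quatEven ⊔ quatOdd = ⊤ := by
  refine eq_top_iff.2 fun v _ => Submodule.mem_sup.2
    ⟨⟨v.re, 0, 0, v.imK⟩, ⟨rfl, rfl⟩, ⟨0, v.imI, v.imJ, 0⟩, ⟨rfl, rfl⟩, ?_⟩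
  ext <;> simp

theorem quatEven_mul_comm {v w : DegQuat} (hv : v ∈ quatEven) : v * w = w * v := by
  obtain ⟨h, hb⟩ := hv
  ext <;> simp [h, hb] <;> ring

theorem quatOdd_mul_comm {v w : DegQuat} (hv : v ∈ quatOdd) (hw : w ∈ quatOdd) :
    v * w = -(w * v) := by
  obtain ⟨h, hb⟩ := hv
  obtain ⟨g, gb⟩ := hw
  ext <;> simp [h, hb, g, gb]
  ring

theorem quatOdd_mul_mem {v w : DegQuat} (hv : v ∈ quatOdd) (hw : w ∈ quatOdd) :
    v * w ∈ quatTop := by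
  obtain ⟨h, hb⟩ := hv
  obtain ⟨g, gb⟩ := hw
  refine ⟨?_, ?_, ?_⟩ <;> simp [h, hb, g, gb]

theorem quatEven_mul_quatOdd_mem {v w : DegQuat} (hv : v ∈ quatEven) (hw : w ∈ quatOdd) :
    v * w ∈ quatOdd := by
  obtain ⟨h, hb⟩ := hv
  obtain ⟨g, gb⟩ := hw
  refine ⟨?_, ?_⟩ <;> simp [h, hb, g, gb]

theorem quatEven_mul_mem {v w : DegQuat} (hv : v ∈ quatEven) (hw : w ∈ quatEven) :
    v * w ∈ quatEven := by
  obtain ⟨h, hb⟩ := hv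
  obtain ⟨g, gb⟩ := hw
  refine ⟨?_, ?_⟩ <;> simp [h, hb, g, gb]

theorem quatOdd_mul_quatTop {v w : DegQuat} (hv : v ∈ quatOdd) (hw : w ∈ quatTop) :
    v * w = 0 := by
  obtain ⟨h, hb⟩ := hv
  obtain ⟨g, gb, gc⟩ := hw
  ext <;> simp [h, hb, g, gb, gc]

theorem quatEven_quatOdd_mul_mem {v w : DegQuat} (hv : v ∈ quatEven) (hw : w ∈ quatOdd) :
    v * w ∈ quatOdd ∧ w * v ∈ quatOdd := by
  rw [← quatEven_mul_comm hv]
  exact ⟨quatEven_mul_quatOdd_mem hv hw, quatEven_mul_quatOdd_mem hv hw⟩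

theorem quatI_mul_quatJ : (⟨0, 1, 0, 0⟩ : DegQuat) * ⟨0, 0, 1, 0⟩ = ⟨0, 0, 0, 1⟩ := by
  ext <;> simp

theorem quatJ_mul_quatI : (⟨0, 0, 1, 0⟩ : DegQuat) * ⟨0, 1, 0, 0⟩ = -⟨0, 0, 0, 1⟩ := by
  ext <;> simp

section Tensor

variable {M : Type*} [AddCommGroup M] [Module ℂ M]

/-- The algebra whose Lie nilpotency class is four. -/
abbrev ExtQuat (M : Type*) [AddCommGroup M] [Module ℂ M] : Type _ :=
  ExteriorAlgebra ℂ M ⊗[ℂ] DegQuat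

/-- The image of `U ⊗ V` in the tensor product. -/
def box (U : Submodule ℂ (ExteriorAlgebra ℂ M)) (V : Submodule ℂ DegQuat) :
    Submodule ℂ (ExtQuat M) :=
  Submodule.map₂ (TensorProduct.mk ℂ _ _) U V

theorem tmul_mem_box {U : Submodule ℂ (ExteriorAlgebra ℂ M)} {V : Submodule ℂ DegQuat}
    {u : ExteriorAlgebra ℂ M} {v : DegQuat} (hu : u ∈ U) (hv : v ∈ V) : u ⊗ₜ[ℂ] v ∈ box U V :=
  Submodule.apply_mem_map₂ _ hu hv

/-- The commutator as a bilinear map. -/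
def lieMap (A : Type*) [Ring A] [Algebra ℂ A] : A →ₗ[ℂ] A →ₗ[ℂ] A :=
  LinearMap.mul ℂ A - (LinearMap.mul ℂ A).flip

theorem lieMap_apply {A : Type*} [Ring A] [Algebra ℂ A] (a b : A) :
    lieMap A a b = a * b - b * a := rfl

theorem lieMap_box_le {U U' : Submodule ℂ (ExteriorAlgebra ℂ M)} {V V' : Submodule ℂ DegQuat}
    {W : Submodule ℂ (ExtQuat M)}
    (h : ∀ u ∈ U, ∀ v ∈ V, ∀ u' ∈ U', ∀ v' ∈ V',
      (u * u') ⊗ₜ[ℂ] (v * v') - (u' * u) ⊗ₜ[ℂ] (v' * v) ∈ W) :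
    Submodule.map₂ (lieMap (ExtQuat M)) (box U V) (box U' V') ≤ W := by
  rw [box, box, Submodule.map₂_eq_span_image2 (TensorProduct.mk ℂ _ _) U V,
    Submodule.map₂_eq_span_image2 (TensorProduct.mk ℂ _ _) U' V', Submodule.map₂_span_span,
    Submodule.span_le]
  rintro _ ⟨_, ⟨u, hu, v, hv, rfl⟩, _, ⟨u', hu', v', hv', rfl⟩, rfl⟩
  simpa [lieMap_apply] using h u hu v hv u' hu' v' hv'

theorem box_sup_eq_top :
    box (extPart M 0) quatEven ⊔ box (extPart M 1) quatEven ⊔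
      (box (extPart M 0) quatOdd ⊔ box (extPart M 1) quatOdd) = ⊤ := by
  simp only [box]
  rw [← Submodule.map₂_sup_left, ← Submodule.map₂_sup_left, ← Submodule.map₂_sup_right,
    extPart_sup, quatEven_sup_quatOdd, TensorProduct.map₂_mk_top_top_eq_top]

theorem lieMap_box_even_eq_bot {p q : ZMod 2} {V V' : Submodule ℂ DegQuat} (hpq : q * p = 0)
    (hV : V ≤ quatEven ∨ V' ≤ quatEven) :
    Submodule.map₂ (lieMap (ExtQuat M)) (box (extPart M p) V) (box (extPart M q) V') = ⊥ := by
  refine le_bot_iff.1 (lieMap_box_le fun u hu v hv u' hu' v' hv' => ?_)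
  have hc : v * v' = v' * v := by
    rcases hV with h | h
    · exact quatEven_mul_comm (h hv)
    · exact (quatEven_mul_comm (h hv')).symm
  simp [extPart_mul_comm hu hu', hpq, hc]

theorem lieMap_box_odd_eq_bot {V V' : Submodule ℂ DegQuat} (hV : V ≤ quatOdd) (hV' : V' ≤ quatOdd) :
    Submodule.map₂ (lieMap (ExtQuat M)) (box (extPart M 1) V) (box (extPart M 1) V') = ⊥ := by
  refine le_bot_iff.1 (lieMap_box_le fun u hu v hv u' hu' v' hv' => ?_)
  simp [extPart_mul_comm hu hu', quatOdd_mul_comm (hV hv) (hV' hv'), TensorProduct.neg_tmul,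
    TensorProduct.tmul_neg]

theorem lieMap_box_le_box {p q r : ZMod 2} {V V' W : Submodule ℂ DegQuat} (hr : p + q = r)
    (hW : ∀ v ∈ V, ∀ v' ∈ V', v * v' ∈ W ∧ v' * v ∈ W) :
    Submodule.map₂ (lieMap (ExtQuat M)) (box (extPart M p) V) (box (extPart M q) V') ≤
      box (extPart M r) W := by
  subst hr
  refine lieMap_box_le fun u hu v hv u' hu' v' hv' => ?_
  refine Submodule.sub_mem _ (tmul_mem_box (extPart_mul_mem hu hu') (hW v hv v' hv').1)
    (tmul_mem_box ?_ (hW v hv v' hv').2)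
  rw [add_comm]
  exact extPart_mul_mem hu' hu

theorem lieMap_top_le {S W : Submodule ℂ (ExtQuat M)}
    (h₁ : Submodule.map₂ (lieMap _) (box (extPart M 0) quatEven) S ≤ W)
    (h₂ : Submodule.map₂ (lieMap _) (box (extPart M 1) quatEven) S ≤ W)
    (h₃ : Submodule.map₂ (lieMap _) (box (extPart M 0) quatOdd) S ≤ W)
    (h₄ : Submodule.map₂ (lieMap _) (box (extPart M 1) quatOdd) S ≤ W) :
    Submodule.map₂ (lieMap (ExtQuat M)) ⊤ S ≤ W := by
  rw [← box_sup_eq_top, Submodule.map₂_sup_left, Submodule.map₂_sup_left, Submodule.map₂_sup_left]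
  exact sup_le (sup_le h₁ h₂) (sup_le h₃ h₄)

theorem lieMap_top_even_even :
    Submodule.map₂ (lieMap (ExtQuat M)) ⊤ (box (extPart M 0) quatEven) ≤ ⊥ := by
  refine lieMap_top_le ?_ ?_ ?_ ?_ <;>
    exact (lieMap_box_even_eq_bot (by decide) (Or.inr le_rfl)).le

theorem lieMap_top_odd_top :
    Submodule.map₂ (lieMap (ExtQuat M)) ⊤ (box (extPart M 1) quatTop) ≤
      box (extPart M 0) quatEven := by
  refine lieMap_top_le ?_ ?_ ?_ ?_
  · exact (lieMap_box_even_eq_bot (by decide) (Or.inl le_rfl)).le.trans bot_le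
  · exact lieMap_box_le_box (by decide) fun v hv w hw =>
      ⟨quatEven_mul_mem hv (quatTop_le_quatEven hw), quatEven_mul_mem (quatTop_le_quatEven hw) hv⟩
  · exact (lieMap_box_even_eq_bot (by decide) (Or.inr quatTop_le_quatEven)).le.trans bot_le
  · refine lieMap_box_le_box (by decide) fun v hv w hw => ?_
    rw [quatEven_mul_comm (quatTop_le_quatEven hw), quatOdd_mul_quatTop hv hw]
    exact ⟨zero_mem _, zero_mem _⟩

theorem lieMap_top_even_odd :
    Submodule.map₂ (lieMap (ExtQuat M)) ⊤ (box (extPart M 0) quatOdd) ≤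
      box (extPart M 0) quatEven ⊔ box (extPart M 1) quatTop := by
  refine lieMap_top_le ?_ ?_ ?_ ?_
  · exact (lieMap_box_even_eq_bot (by decide) (Or.inl le_rfl)).le.trans bot_le
  · exact (lieMap_box_even_eq_bot (by decide) (Or.inl le_rfl)).le.trans bot_le
  · exact le_sup_of_le_left <| lieMap_box_le_box (by decide) fun v hv w hw =>
      ⟨quatTop_le_quatEven (quatOdd_mul_mem hv hw), quatTop_le_quatEven (quatOdd_mul_mem hw hv)⟩
  · exact le_sup_of_le_right <| lieMap_box_le_box (by decide) fun v hv w hw =>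
      ⟨quatOdd_mul_mem hv hw, quatOdd_mul_mem hw hv⟩

theorem lieMap_top_top :
    Submodule.map₂ (lieMap (ExtQuat M)) ⊤ ⊤ ≤
      (box (extPart M 0) quatEven ⊔ box (extPart M 1) quatTop) ⊔ box (extPart M 0) quatOdd := by
  conv_lhs => arg 3; rw [← box_sup_eq_top]
  rw [Submodule.map₂_sup_right, Submodule.map₂_sup_right, Submodule.map₂_sup_right]
  refine sup_le (sup_le ?_ ?_) (sup_le ?_ ?_)
  · exact lieMap_top_even_even.trans bot_le
  · refine lieMap_top_le ?_ ?_ ?_ ?_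
    · exact (lieMap_box_even_eq_bot (by decide) (Or.inl le_rfl)).le.trans bot_le
    · exact le_sup_of_le_left <| le_sup_of_le_left <| lieMap_box_le_box (by decide)
        fun v hv w hw => ⟨quatEven_mul_mem hv hw, quatEven_mul_mem hw hv⟩
    · exact (lieMap_box_even_eq_bot (by decide) (Or.inr le_rfl)).le.trans bot_le
    · exact le_sup_of_le_right <| lieMap_box_le_box (by decide)
        fun v hv w hw => (quatEven_quatOdd_mul_mem hw hv).symm
  · exact le_sup_of_le_left lieMap_top_even_odd
  · refine lieMap_top_le ?_ ?_ ?_ ?_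
    · exact (lieMap_box_even_eq_bot (by decide) (Or.inl le_rfl)).le.trans bot_le
    · exact le_sup_of_le_right <| lieMap_box_le_box (by decide)
        fun v hv w hw => quatEven_quatOdd_mul_mem hv hw
    · exact le_sup_of_le_left <| le_sup_of_le_right <| lieMap_box_le_box (by decide)
        fun v hv w hw => ⟨quatOdd_mul_mem hv hw, quatOdd_mul_mem hw hv⟩
    · exact (lieMap_box_odd_eq_bot le_rfl le_rfl).le.trans bot_le

/-- A filtration of `ExtQuat M` containing its lower central series. -/
def extQuatFiltration (M : Type*) [AddCommGroup M] [Module ℂ M] : ℕ → Submodule ℂ (ExtQuat M)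
  | 0 => ⊤
  | 1 => (box (extPart M 0) quatEven ⊔ box (extPart M 1) quatTop) ⊔ box (extPart M 0) quatOdd
  | 2 => box (extPart M 0) quatEven ⊔ box (extPart M 1) quatTop
  | 3 => box (extPart M 0) quatEven
  | _ + 4 => ⊥

theorem lieMap_extQuatFiltration_le (n : ℕ) :
    Submodule.map₂ (lieMap (ExtQuat M)) ⊤ (extQuatFiltration M n) ≤
      extQuatFiltration M (n + 1) := by
  match n with
  | 0 => exact lieMap_top_top
  | 1 =>
    simp only [extQuatFiltration, Submodule.map₂_sup_right]
    exact sup_le (sup_le (lieMap_top_even_even.trans bot_le)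
      (le_sup_of_le_left lieMap_top_odd_top)) lieMap_top_even_odd
  | 2 =>
    simp only [extQuatFiltration, Submodule.map₂_sup_right]
    exact sup_le (lieMap_top_even_even.trans bot_le) lieMap_top_odd_top
  | 3 => exact lieMap_top_even_even
  | n + 4 => exact (Submodule.map₂_bot_right _ _).le

theorem map_Mser_five_eq_zero {A : Type*} [Ring A] [Algebra ℂ A] (f : A →ₐ[ℂ] ExtQuat M) :
    ∀ x ∈ Mser ℂ A 5, f x = 0 := by
  refine map_eq_zero_of_mem_Mser f 5 fun x hx => ?_
  refine (Submodule.mem_bot ℂ).1 (map_mem_of_mem_lcs f (extQuatFiltration M) rfl ?_ 4 x hx)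
  intro n a b hb
  exact lieMap_extQuatFiltration_le n (Submodule.apply_mem_map₂ (lieMap _) trivial hb)

theorem ringComm_tmul {u u' : ExteriorAlgebra ℂ M} {v v' : DegQuat}
    (h : (u' * u) ⊗ₜ[ℂ] (v' * v) = -((u * u') ⊗ₜ[ℂ] (v * v'))) :
    ringComm (u ⊗ₜ[ℂ] v) (u' ⊗ₜ[ℂ] v') = (2 : ℂ) • ((u * u') ⊗ₜ[ℂ] (v * v')) := by
  rw [ringComm, Algebra.TensorProduct.tmul_mul_tmul, Algebra.TensorProduct.tmul_mul_tmul, h,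
    sub_neg_eq_add, two_smul]

theorem ringComm_smul_left {A : Type*} [Ring A] [Algebra ℂ A] (r : ℂ) (a b : A) :
    ringComm (r • a) b = r • ringComm a b := by
  simp [ringComm, smul_sub]

/-- The value of the product of a commutator of length two and one of length four. -/
theorem ringComm_mul_ringComm_extQuat (x y a b c d : M) :
    ringComm (ExteriorAlgebra.ι ℂ x ⊗ₜ[ℂ] (1 : DegQuat)) (ExteriorAlgebra.ι ℂ y ⊗ₜ[ℂ] 1) *
      ringComm (ringComm (ringComm (ExteriorAlgebra.ι ℂ a ⊗ₜ[ℂ] (⟨0, 1, 0, 0⟩ : DegQuat))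
        (ExteriorAlgebra.ι ℂ b ⊗ₜ[ℂ] 1)) (ExteriorAlgebra.ι ℂ c ⊗ₜ[ℂ] ⟨0, 0, 1, 0⟩))
        (ExteriorAlgebra.ι ℂ d ⊗ₜ[ℂ] 1) =
      (16 : ℂ) • (ExteriorAlgebra.ιMulti ℂ 6 ![x, y, a, b, c, d] ⊗ₜ[ℂ] ⟨0, 0, 0, 1⟩) := by
  have hxy (m m' : M) (v : DegQuat) :
      ringComm (ExteriorAlgebra.ι ℂ m ⊗ₜ[ℂ] v) (ExteriorAlgebra.ι ℂ m' ⊗ₜ[ℂ] 1) =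
        (2 : ℂ) • ((ExteriorAlgebra.ι ℂ m * ExteriorAlgebra.ι ℂ m') ⊗ₜ[ℂ] v) := by
    rw [ringComm_tmul, mul_one]
    rw [extPart_mul_comm (ι_mem_extPart_one m') (ι_mem_extPart_one m), mul_one, one_mul]
    simp [TensorProduct.neg_tmul]
  have hc : ringComm ((ExteriorAlgebra.ι ℂ a * ExteriorAlgebra.ι ℂ b) ⊗ₜ[ℂ]
      (⟨0, 1, 0, 0⟩ : DegQuat)) (ExteriorAlgebra.ι ℂ c ⊗ₜ[ℂ] ⟨0, 0, 1, 0⟩) =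
        (2 : ℂ) • ((ExteriorAlgebra.ι ℂ a * ExteriorAlgebra.ι ℂ b * ExteriorAlgebra.ι ℂ c) ⊗ₜ[ℂ]
          ⟨0, 0, 0, 1⟩) := by
    rw [ringComm_tmul, quatI_mul_quatJ]
    rw [extPart_mul_comm (ι_mem_extPart_one c) (ι_mul_ι_mem_extPart_zero a b), quatI_mul_quatJ,
      quatJ_mul_quatI, TensorProduct.tmul_neg, zero_mul, uzpow_zero, one_smul]
  have hd (v : DegQuat) : ringComm ((ExteriorAlgebra.ι ℂ a * ExteriorAlgebra.ι ℂ b *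
      ExteriorAlgebra.ι ℂ c) ⊗ₜ[ℂ] v) (ExteriorAlgebra.ι ℂ d ⊗ₜ[ℂ] 1) =
        (2 : ℂ) • ((ExteriorAlgebra.ι ℂ a * ExteriorAlgebra.ι ℂ b * ExteriorAlgebra.ι ℂ c *
          ExteriorAlgebra.ι ℂ d) ⊗ₜ[ℂ] v) := by
    rw [ringComm_tmul, mul_one]
    rw [extPart_mul_comm (ι_mem_extPart_one d)
      (extPart_mul_mem (ι_mul_ι_mem_extPart_zero a b) (ι_mem_extPart_one c)), mul_one, one_mul]
    simp [TensorProduct.neg_tmul]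
  have hprod : ExteriorAlgebra.ιMulti ℂ 6 ![x, y, a, b, c, d] =
      (ExteriorAlgebra.ι ℂ x * ExteriorAlgebra.ι ℂ y) * (ExteriorAlgebra.ι ℂ a *
        ExteriorAlgebra.ι ℂ b * ExteriorAlgebra.ι ℂ c * ExteriorAlgebra.ι ℂ d) := by
    simp [ExteriorAlgebra.ιMulti_apply, mul_assoc]
  rw [hxy, hxy, ringComm_smul_left, hc, ringComm_smul_left, ringComm_smul_left, hd, hprod,
    smul_smul, smul_smul, smul_mul_smul_comm, Algebra.TensorProduct.tmul_mul_tmul, one_mul]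
  norm_num

theorem ιMulti_tmul_ne_zero :
    ExteriorAlgebra.ιMulti ℂ 6 (fun i => (Pi.single i 1 : Fin 6 → ℂ)) ⊗ₜ[ℂ]
      (⟨0, 0, 0, 1⟩ : DegQuat) ≠ 0 := by
  intro h
  let g : ExteriorAlgebra ℂ (Fin 6 → ℂ) →ₗ[ℂ] ℂ :=
    ExteriorAlgebra.liftAlternating (Pi.single 6 (Pi.basisFun ℂ (Fin 6)).det)
  let k : DegQuat →ₗ[ℂ] ℂ :=
    { toFun := fun v => v.imK, map_add' := fun _ _ => rfl, map_smul' := fun _ _ => rfl }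
  have hb := congrArg (TensorProduct.lid ℂ ℂ ∘ TensorProduct.map g k) h
  have hdet := (Pi.basisFun ℂ (Fin 6)).det_self
  rw [show ⇑(Pi.basisFun ℂ (Fin 6)) = fun i => Pi.single i 1 from funext fun i => by simp] at hdet
  simp only [g, k, Function.comp_apply, TensorProduct.map_tmul, TensorProduct.lid_tmul, map_zero,
    ExteriorAlgebra.liftAlternating_apply_ιMulti, Pi.single_eq_same, hdet] at hb
  simp at hb

end Tensor

/-- The pair (2,4) is not null: in the free associative unital `ℂ`-algebra on six
generators, the element `[x_1,x_2] · [[[x_3,x_4],x_5],x_6]` does not belong to `M_5`. -/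
theorem pair_two_four_not_null :
    ringComm (FreeAlgebra.ι ℂ (0 : Fin 6)) (FreeAlgebra.ι ℂ (1 : Fin 6)) *
      ringComm (ringComm (ringComm (FreeAlgebra.ι ℂ (2 : Fin 6)) (FreeAlgebra.ι ℂ (3 : Fin 6)))
        (FreeAlgebra.ι ℂ (4 : Fin 6))) (FreeAlgebra.ι ℂ (5 : Fin 6)) ∉
        Mser ℂ (FreeAlgebra ℂ (Fin 6)) 5 := by
  intro hmem
  let e (i : Fin 6) : Fin 6 → ℂ := Pi.single i 1
  let q : Fin 6 → DegQuat := ![1, 1, ⟨0, 1, 0, 0⟩, 1, ⟨0, 0, 1, 0⟩, 1]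
  let f : FreeAlgebra ℂ (Fin 6) →ₐ[ℂ] ExtQuat (Fin 6 → ℂ) :=
    FreeAlgebra.lift ℂ fun i => ExteriorAlgebra.ι ℂ (e i) ⊗ₜ[ℂ] q i
  have hcomm (a b : FreeAlgebra ℂ (Fin 6)) : f (ringComm a b) = ringComm (f a) (f b) := by
    simp [ringComm]
  have hι (i : Fin 6) : f (FreeAlgebra.ι ℂ i) = ExteriorAlgebra.ι ℂ (e i) ⊗ₜ[ℂ] q i :=
    FreeAlgebra.lift_ι_apply _ _
  have h := map_Mser_five_eq_zero f _ hmem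
  rw [map_mul, hcomm, hcomm, hcomm, hcomm, hι, hι, hι, hι, hι, hι] at h
  have h16 := (ringComm_mul_ringComm_extQuat (e 0) (e 1) (e 2) (e 3) (e 4) (e 5)).symm.trans h
  have he : ![e 0, e 1, e 2, e 3, e 4, e 5] = e := by
    ext i : 1
    fin_cases i <;> rfl
  rw [he] at h16
  exact ιMulti_tmul_ne_zero ((smul_eq_zero.1 h16).resolve_left (by norm_num))
end
end

section
/- In the free associative unital ℂ-algebra A_n on generators x_1,…,x_n, for all indices i, j, k, l, m the element [x_i,x_j]·[x_k,[x_l,x_m]] + [x_k,x_j]·[x_i,[x_l,x_m]] belongs to M_4(A_n); equivalently, in Q_{n,4} = A_n/M_4(A_n) one has [x_i,x_j][x_k,[x_l,x_m]] + [x_k,x_j][x_i,[x_l,x_m]] = 0. -/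
noncomputable section

/-- Four-fold commutators, multiplied by arbitrary elements on both sides, lie in `M_4`. -/
lemma mul_ringComm_mul_mem_Mser_four (k : Type*) {A : Type*} [Field k] [Ring A] [Algebra k A]
    (p q a b c d : A) :
    p * ringComm a (ringComm b (ringComm c d)) * q ∈ Mser k A 4 :=
  Submodule.subset_span ⟨p, q, _, Submodule.subset_span ⟨a, _, Submodule.subset_span
    ⟨b, _, Submodule.subset_span ⟨c, d, Submodule.mem_top, rfl⟩, rfl⟩, rfl⟩, rfl⟩

/-- The relation `[a,b][c,[d,e]] + [c,b][a,[d,e]] ∈ M_4`, obtained by expanding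
`[b,[ac,[d,e]]]`; it holds in every algebra. -/
lemma ringComm_mul_add_mem_Mser_four (k : Type*) {A : Type*} [Field k] [Ring A] [Algebra k A]
    (a b c d e : A) :
    ringComm a b * ringComm c (ringComm d e) + ringComm c b * ringComm a (ringComm d e) ∈
      Mser k A 4 := by
  have expand : ringComm a b * ringComm c (ringComm d e) +
        ringComm c b * ringComm a (ringComm d e) =
      a * ringComm b (ringComm c (ringComm d e)) * 1 +
        1 * ringComm b (ringComm a (ringComm d e)) * c -
        1 * ringComm b (ringComm (a * c) (ringComm d e)) * 1 -
        1 * ringComm (ringComm b c) (ringComm a (ringComm d e)) * 1 := by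
    simp only [ringComm]
    noncomm_ring
  rw [expand]
  exact sub_mem (sub_mem (add_mem (mul_ringComm_mul_mem_Mser_four k _ _ _ _ _ _)
    (mul_ringComm_mul_mem_Mser_four k _ _ _ _ _ _))
    (mul_ringComm_mul_mem_Mser_four k _ _ _ _ _ _))
    (mul_ringComm_mul_mem_Mser_four k _ _ _ _ _ _)

/-- In the free associative unital `ℂ`-algebra on `n` generators, for all indices
`i, j, k, l, m` the element `[x_i,x_j]·[x_k,[x_l,x_m]] + [x_k,x_j]·[x_i,[x_l,x_m]]`
belongs to `M_4`; equivalently, it vanishes in `Q_{n,4}`. -/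
theorem S_mem_Mser_four (n : ℕ) (i j k l m : Fin n) :
    ringComm (FreeAlgebra.ι ℂ i) (FreeAlgebra.ι ℂ j) *
        ringComm (FreeAlgebra.ι ℂ k) (ringComm (FreeAlgebra.ι ℂ l) (FreeAlgebra.ι ℂ m)) +
      ringComm (FreeAlgebra.ι ℂ k) (FreeAlgebra.ι ℂ j) *
        ringComm (FreeAlgebra.ι ℂ i) (ringComm (FreeAlgebra.ι ℂ l) (FreeAlgebra.ι ℂ m)) ∈
      Mser ℂ (FreeAlgebra ℂ (Fin n)) 4 :=
  ringComm_mul_add_mem_Mser_four ℂ _ _ _ _ _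
end
end

section
/- Let A_n be the free associative unital ℂ-algebra on generators x_1,…,x_n. The ideal M_3(A_n) equals the two-sided ideal of A_n generated by the elements [x_i,[x_j,x_l]] for all 1 ≤ i,j,l ≤ n together with the elements [x_i,x_j][x_k,x_l] + [x_i,x_k][x_j,x_l] for all 1 ≤ i,j,k,l ≤ n. (Equivalently, Q_{n,3} is generated by x_i and y_{ij} = [x_i,x_j] with defining relations [x_i,y_{jl}] = 0 and y_{ij}y_{kl} + y_{ik}y_{jl} = 0.) -/
noncomputable section

section IdealGen

variable {k A : Type*} [Field k] [Ring A] [Algebra k A] {S : Set A}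

lemma subset_idealGen_s11 : S ⊆ idealGen k S := fun s hs =>
  Submodule.subset_span ⟨1, 1, s, hs, by simp⟩

lemma mul_mem_idealGen_left (c : A) {x : A} (hx : x ∈ idealGen k S) : c * x ∈ idealGen k S := by
  refine (Submodule.span_le (p := (idealGen k S).comap (LinearMap.mulLeft k c))).2 ?_ hx
  rintro _ ⟨a, b, s, hs, rfl⟩
  exact Submodule.subset_span ⟨c * a, b, s, hs, by simp [mul_assoc]⟩

lemma mul_mem_idealGen_right (c : A) {x : A} (hx : x ∈ idealGen k S) : x * c ∈ idealGen k S := by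
  refine (Submodule.span_le (p := (idealGen k S).comap (LinearMap.mulRight k c))).2 ?_ hx
  rintro _ ⟨a, b, s, hs, rfl⟩
  exact Submodule.subset_span ⟨a, b * c, s, hs, by simp [mul_assoc]⟩

lemma idealGen_le {p : Submodule k A} (hl : ∀ c, ∀ x ∈ p, c * x ∈ p) (hr : ∀ c, ∀ x ∈ p, x * c ∈ p)
    (hS : S ⊆ p) : idealGen k S ≤ p := by
  refine Submodule.span_le.2 ?_
  rintro _ ⟨a, b, s, hs, rfl⟩
  exact hr _ _ (hl _ _ (hS hs))

lemma ringComm_ringComm_mem_Mser_three (a b c : A) :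
    ringComm a (ringComm b c) ∈ Mser k A 3 :=
  subset_idealGen_s11 <| Submodule.subset_span
    ⟨a, _, Submodule.subset_span ⟨b, c, Submodule.mem_top, rfl⟩, rfl⟩

lemma Mser_three_le {p : Submodule k A} (hl : ∀ c, ∀ x ∈ p, c * x ∈ p)
    (hr : ∀ c, ∀ x ∈ p, x * c ∈ p) (h : ∀ a b c, ringComm a (ringComm b c) ∈ p) :
    Mser k A 3 ≤ p := by
  refine idealGen_le hl hr (Submodule.span_le.2 ?_)
  rintro _ ⟨a, y, hy, rfl⟩
  refine (Submodule.span_le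
    (p := p.comap (LinearMap.mulLeft k a - LinearMap.mulRight k a))).2 ?_ hy
  rintro _ ⟨b, c, -, rfl⟩
  exact h a b c

lemma ringComm_mul_ringComm_add_mem_Mser_three (a b c d : A) :
    ringComm a b * ringComm c d + ringComm a c * ringComm b d ∈ Mser k A 3 := by
  have h : ringComm a b * ringComm c d + ringComm a c * ringComm b d =
      ringComm d (ringComm a b) * c + b * ringComm d (ringComm a c)
        - ringComm d (ringComm a (b * c)) - ringComm (ringComm b d) (ringComm a c) := by
    simp only [ringComm]; noncomm_ring
  rw [h]
  exact sub_mem (sub_mem (add_mem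
    (mul_mem_idealGen_right _ (ringComm_ringComm_mem_Mser_three _ _ _))
    (mul_mem_idealGen_left _ (ringComm_ringComm_mem_Mser_three _ _ _)))
    (ringComm_ringComm_mem_Mser_three _ _ _)) (ringComm_ringComm_mem_Mser_three _ _ _)

/-- `idealGen k S` as a bundled two-sided ideal. -/
def idealGenTwoSided (k : Type*) {A : Type*} [Field k] [Ring A] [Algebra k A] (S : Set A) :
    TwoSidedIdeal A :=
  .mk' (idealGen k S) (zero_mem _) add_mem neg_mem (mul_mem_idealGen_left _)
    (mul_mem_idealGen_right _)

lemma mem_idealGenTwoSided {x : A} : x ∈ idealGenTwoSided k S ↔ x ∈ idealGen k S :=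
  TwoSidedIdeal.mem_mk' ..

lemma mk_eq_zero_iff_mem_idealGen {x : A} :
    (idealGenTwoSided k S).ringCon.mk' x = 0 ↔ x ∈ idealGen k S := by
  rw [← mem_idealGenTwoSided, TwoSidedIdeal.mem_iff, ← RingCon.eq]
  rfl

end IdealGen

lemma map_ringComm {A B : Type*} [Ring A] [Ring B] (f : A →+* B) (a b : A) :
    f (ringComm a b) = ringComm (f a) (f b) := by
  simp [ringComm]

section Generated

variable {R Q ι : Type*} [CommRing R] [Ring Q] [Algebra R Q] {X : ι → Q}

lemma commute_of_commute_generators (hX : Algebra.adjoin R (Set.range X) = ⊤) {c : Q}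
    (hc : ∀ i, Commute c (X i)) (q : Q) : Commute c q := by
  have hq : q ∈ Algebra.adjoin R (Set.range X) := hX ▸ Algebra.mem_top
  induction hq using Algebra.adjoin_induction with
  | mem x hx => obtain ⟨i, rfl⟩ := hx; exact hc i
  | algebraMap r => exact Algebra.commute_algebraMap_right r c
  | add x y _ _ hx hy => exact hx.add_right hy
  | mul x y _ _ hx hy => exact hx.mul_right hy

/-- A combination of two inner derivations with central coefficients vanishes as soon as it
vanishes on generators. -/
lemma central_mul_ringComm_add_eq_zero (hX : Algebra.adjoin R (Set.range X) = ⊤) {p q s t : Q}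
    (hp : ∀ c, Commute p c) (hq : ∀ c, Commute q c)
    (h : ∀ i, p * ringComm s (X i) + q * ringComm t (X i) = 0) (b : Q) :
    p * ringComm s b + q * ringComm t b = 0 := by
  have hb : b ∈ Algebra.adjoin R (Set.range X) := hX ▸ Algebra.mem_top
  induction hb using Algebra.adjoin_induction with
  | mem x hx => obtain ⟨i, rfl⟩ := hx; exact h i
  | algebraMap r =>
    simp [ringComm, (Algebra.commutes r s).symm, (Algebra.commutes r t).symm]
  | add x y _ _ hx hy =>
    calc _ = (p * ringComm s x + q * ringComm t x) + (p * ringComm s y + q * ringComm t y) := by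
          simp only [ringComm]; noncomm_ring
      _ = 0 := by rw [hx, hy, add_zero]
  | mul x y _ _ hx hy =>
    calc _ = (p * ringComm s x + q * ringComm t x) * y + p * x * ringComm s y
            + q * x * ringComm t y := by simp only [ringComm]; noncomm_ring
      _ = x * (p * ringComm s y + q * ringComm t y) := by
          rw [hx, (hp x).eq, (hq x).eq]; noncomm_ring
      _ = 0 := by rw [hy, mul_zero]

lemma ringComm_swap (a b : Q) : ringComm a b = -ringComm b a := by
  simp [ringComm]

lemma commute_ringComm_generators (hX : Algebra.adjoin R (Set.range X) = ⊤)
    (h₁ : ∀ i j l, ringComm (X i) (ringComm (X j) (X l)) = 0)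
    (j l : ι) (q : Q) : Commute (ringComm (X j) (X l)) q :=
  commute_of_commute_generators hX (fun i => (sub_eq_zero.1 (h₁ i j l)).symm) q

lemma ringComm_mul_generators_add_eq_zero (hX : Algebra.adjoin R (Set.range X) = ⊤)
    (h₁ : ∀ i j l, ringComm (X i) (ringComm (X j) (X l)) = 0)
    (h₂ : ∀ i j k l, ringComm (X i) (X j) * ringComm (X k) (X l)
      + ringComm (X i) (X k) * ringComm (X j) (X l) = 0)
    (a : Q) (j k l : ι) :
    ringComm a (X j) * ringComm (X k) (X l) + ringComm a (X k) * ringComm (X j) (X l) = 0 := by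
  have hc := commute_ringComm_generators hX h₁
  have := central_mul_ringComm_add_eq_zero hX (hc k l) (hc j l) (s := X j) (t := X k)
    (fun i => by
      rw [(hc k l _).eq, (hc j l _).eq, ringComm_swap (X j), ringComm_swap (X k) (X i),
        neg_mul, neg_mul, ← neg_add, h₂, neg_zero]) a
  rw [(hc k l _).eq, (hc j l _).eq, ringComm_swap (X j), ringComm_swap (X k) a,
    neg_mul, neg_mul, ← neg_add, neg_eq_zero] at this
  exact this

lemma ringComm_mul_ringComm_generator_add_eq_zero (hX : Algebra.adjoin R (Set.range X) = ⊤)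
    (h₁ : ∀ i j l, ringComm (X i) (ringComm (X j) (X l)) = 0)
    (h₂ : ∀ i j k l, ringComm (X i) (X j) * ringComm (X k) (X l)
      + ringComm (X i) (X k) * ringComm (X j) (X l) = 0)
    {a : Q}
    (ha : ∀ j q, Commute (ringComm a (X j)) q) (b : Q) (j m : ι) :
    ringComm a (X m) * ringComm b (X j) + ringComm a (X j) * ringComm b (X m) = 0 := by
  have hR := ringComm_mul_generators_add_eq_zero hX h₁ h₂ a
  have := central_mul_ringComm_add_eq_zero hX (ha m) (ha j) (s := X j) (t := X m)
    (fun i => by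
      have e := congrArg₂ (· + ·) (hR m i j) (hR j i m)
      simp only [ringComm_swap (X i), ringComm_swap (X m) (X j), mul_neg, add_zero] at e
      rw [← neg_eq_zero, ← e]; abel) b
  rw [ringComm_swap (X j), ringComm_swap (X m) b, mul_neg, mul_neg, ← neg_add, neg_eq_zero] at this
  exact this

lemma commute_ringComm_generator (hX : Algebra.adjoin R (Set.range X) = ⊤)
    (h₁ : ∀ i j l, ringComm (X i) (ringComm (X j) (X l)) = 0)
    (h₂ : ∀ i j k l, ringComm (X i) (X j) * ringComm (X k) (X l)
      + ringComm (X i) (X k) * ringComm (X j) (X l) = 0)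
    (a : Q) (j : ι) (q : Q) : Commute (ringComm a (X j)) q := by
  have ha : a ∈ Algebra.adjoin R (Set.range X) := hX ▸ Algebra.mem_top
  induction ha using Algebra.adjoin_induction generalizing j q with
  | mem x hx => obtain ⟨i, rfl⟩ := hx; exact commute_ringComm_generators hX h₁ i j q
  | algebraMap r => simp [ringComm, Algebra.commutes r (X j)]
  | add x y _ _ hx hy =>
    have : ringComm (x + y) (X j) = ringComm x (X j) + ringComm y (X j) := by
      simp only [ringComm]; noncomm_ring
    exact this ▸ (hx j q).add_left (hy j q)
  | mul x y _ _ hx hy =>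
    refine commute_of_commute_generators hX (fun m => sub_eq_zero.1 ?_) q
    have hxj := (hx j (X m)).eq
    have hyj := (hy j (X m)).eq
    calc _ = x * (ringComm y (X j) * X m - X m * ringComm y (X j))
            + (ringComm x (X j) * X m - X m * ringComm x (X j)) * y
            + (ringComm x (X m) * ringComm y (X j) + ringComm x (X j) * ringComm y (X m)) := by
          simp only [ringComm]; noncomm_ring
      _ = 0 := by
          rw [hxj, hyj, ringComm_mul_ringComm_generator_add_eq_zero hX h₁ h₂ hx]; simp

lemma commute_ringComm (hX : Algebra.adjoin R (Set.range X) = ⊤)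
    (h₁ : ∀ i j l, ringComm (X i) (ringComm (X j) (X l)) = 0)
    (h₂ : ∀ i j k l, ringComm (X i) (X j) * ringComm (X k) (X l)
      + ringComm (X i) (X k) * ringComm (X j) (X l) = 0)
    (a b q : Q) : Commute (ringComm a b) q := by
  have hc := commute_ringComm_generator hX h₁ h₂
  have hR := ringComm_mul_generators_add_eq_zero hX h₁ h₂
  have hb : b ∈ Algebra.adjoin R (Set.range X) := hX ▸ Algebra.mem_top
  induction hb using Algebra.adjoin_induction generalizing q with
  | mem x hx => obtain ⟨i, rfl⟩ := hx; exact hc a i q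
  | algebraMap r => simp [ringComm, (Algebra.commutes r a).symm]
  | add x y _ _ hx hy =>
    have : ringComm a (x + y) = ringComm a x + ringComm a y := by
      simp only [ringComm]; noncomm_ring
    exact this ▸ (hx q).add_left (hy q)
  | mul x y _ _ hx hy =>
    refine commute_of_commute_generators hX (fun m => sub_eq_zero.1 ?_) q
    have hgen (l : ι) : ringComm x (X m) * ringComm a (X l)
        + ringComm a x * ringComm (X l) (X m) = 0 := by
      have := central_mul_ringComm_add_eq_zero hX (hc a l) (hc (X l) m) (s := X m) (t := -a)
        (fun i => by
          have e := hR a l i m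
          have : ringComm (-a) (X i) = -ringComm a (X i) := by
            simp only [ringComm]; noncomm_ring
          rw [this, ringComm_swap (X m), mul_neg, mul_neg, (hc (X l) m _).eq, ← neg_add, e,
            neg_zero]) x
      have e : ringComm (-a) x = -ringComm a x := by simp only [ringComm]; noncomm_ring
      rw [e, ringComm_swap (X m), mul_neg, mul_neg, (hc (X l) m _).eq, (hc a l _).eq, ← neg_add,
        neg_eq_zero] at this
      exact this
    have hU := central_mul_ringComm_add_eq_zero hX (hc x m) hx (s := a) (t := -X m)
      (fun i => by
        have e : ringComm (-X m) (X i) = ringComm (X i) (X m) := by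
          simp only [ringComm]; noncomm_ring
        rw [e, hgen]) y
    calc _ = x * (ringComm a y * X m - X m * ringComm a y)
            + (ringComm a x * X m - X m * ringComm a x) * y
            + (ringComm x (X m) * ringComm a y + ringComm a x * ringComm (-X m) y) := by
          simp only [ringComm]; noncomm_ring
      _ = 0 := by rw [hU, (hx (X m)).eq, (hy (X m)).eq]; simp

end Generated

/-- **Feigin–Shoikhet.** In the free associative unital `ℂ`-algebra on `n` generators,
the ideal `M_3` equals the two-sided ideal generated by the elements `[x_i,[x_j,x_l]]`
together with the elements `[x_i,x_j][x_k,x_l] + [x_i,x_k][x_j,x_l]`. -/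
theorem Mser_three_eq_idealGen (n : ℕ) :
    Mser ℂ (FreeAlgebra ℂ (Fin n)) 3 =
      idealGen ℂ
        ({w | ∃ i j l : Fin n,
            w = ringComm (FreeAlgebra.ι ℂ i) (ringComm (FreeAlgebra.ι ℂ j) (FreeAlgebra.ι ℂ l))} ∪
         {w | ∃ i j k l : Fin n,
            w = ringComm (FreeAlgebra.ι ℂ i) (FreeAlgebra.ι ℂ j) *
                  ringComm (FreeAlgebra.ι ℂ k) (FreeAlgebra.ι ℂ l) +
                ringComm (FreeAlgebra.ι ℂ i) (FreeAlgebra.ι ℂ k) *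
                  ringComm (FreeAlgebra.ι ℂ j) (FreeAlgebra.ι ℂ l)}) := by
  refine le_antisymm (Mser_three_le (fun _ _ => mul_mem_idealGen_left _)
    (fun _ _ => mul_mem_idealGen_right _) fun a b c => ?_)
    (idealGen_le (fun _ _ => mul_mem_idealGen_left _) (fun _ _ => mul_mem_idealGen_right _) ?_)
  · set S : Set (FreeAlgebra ℂ (Fin n)) := _ ∪ _
    let π := (idealGenTwoSided ℂ S).ringCon.mk'
    let πA : FreeAlgebra ℂ (Fin n) →ₐ[ℂ] (idealGenTwoSided ℂ S).ringCon.Quotient :=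
      { π with commutes' := fun _ => rfl }
    have hX : Algebra.adjoin ℂ (Set.range fun i => π (FreeAlgebra.ι ℂ i)) = ⊤ := by
      have h := congrArg (Subalgebra.map πA) (FreeAlgebra.adjoin_range_ι (R := ℂ) (X := Fin n))
      rw [AlgHom.map_adjoin, ← Set.range_comp, Algebra.map_top] at h
      exact h.trans ((AlgHom.range_eq_top _).2 (RingCon.mk'_surjective _))
    rw [← mk_eq_zero_iff_mem_idealGen]
    change π _ = 0
    rw [map_ringComm, map_ringComm]
    refine sub_eq_zero.2 (commute_ringComm hX (fun i j l => ?_) (fun i j k l => ?_) _ _ _).symm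
    · rw [← map_ringComm, ← map_ringComm]
      exact mk_eq_zero_iff_mem_idealGen.2 (subset_idealGen_s11 (.inl ⟨i, j, l, rfl⟩))
    · simp only [← map_ringComm, ← map_mul, ← map_add]
      exact mk_eq_zero_iff_mem_idealGen.2 (subset_idealGen_s11 (.inr ⟨i, j, k, l, rfl⟩))
  · rintro _ (⟨i, j, l, rfl⟩ | ⟨i, j, k, l, rfl⟩)
    · exact ringComm_ringComm_mem_Mser_three _ _ _
    · exact ringComm_mul_ringComm_add_mem_Mser_three _ _ _ _
end
end
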